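/- Let p be an odd prime. Equip (ZMod p²)³ with the bilinear form b(x,y) = x₁y₃ + x₂y₂ + x₃y₁, and define the Lagrangian submodules L_{p+1} = p·(ZMod p²)³, L_p = span{(0,0,1),(0,p,0)}, and L_a = span{(1, a, −2⁻¹·a²), (0, p, −p·a)} for a ∈ {0, 1, …, p−1}, where 2⁻¹ is the inverse of 2 in ZMod p². Then: (i) for all indices 0 ≤ i < j ≤ p (i.e. among L₀, …, L_{p−1}, L_p), the cardinality of L_i ∩ L_j equals p; and (ii) for every 0 ≤ i ≤ p, the cardinality of L_i ∩ L_{p+1} equals p². -/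

import Mathlib

/-- The Lagrangian submodules of `(ZMod p²)³` (for `b(x,y) = x₁y₃ + x₂y₂ + x₃y₁`),
indexed by `k ∈ {0, …, p+1}`: for `k < p`, `L_k = span{(1, k, −2⁻¹k²), (0, p, −pk)}`;
`L_p = span{(0,0,1), (0,p,0)}`; and `L_{p+1} = p·(ZMod p²)³`. -/
def LL (p k : ℕ) : Submodule (ZMod (p ^ 2)) (Fin 3 → ZMod (p ^ 2)) :=
  if k < p then
    Submodule.span (ZMod (p ^ 2))
      {![1, (k : ZMod (p ^ 2)), -((2 : ZMod (p ^ 2))⁻¹ * (k : ZMod (p ^ 2)) ^ 2)],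
       ![0, (p : ZMod (p ^ 2)), -((p : ZMod (p ^ 2)) * (k : ZMod (p ^ 2)))]}
  else if k = p then
    Submodule.span (ZMod (p ^ 2)) {![0, 0, 1], ![0, (p : ZMod (p ^ 2)), 0]}
  else
    LinearMap.range ((p : ZMod (p ^ 2)) •
      (LinearMap.id : (Fin 3 → ZMod (p ^ 2)) →ₗ[ZMod (p ^ 2)] (Fin 3 → ZMod (p ^ 2))))

section Membership

variable {p k : ℕ} {x : Fin 3 → ZMod (p ^ 2)}

theorem mem_LL_of_lt (hk : k < p) :
    x ∈ LL p k ↔ ∃ t, x 1 = k * x 0 + p * t ∧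
      x 2 = -(2⁻¹ * (k : ZMod (p ^ 2)) ^ 2 * x 0) - p * k * t := by
  rw [LL, if_pos hk, Submodule.mem_span_pair]
  constructor
  · rintro ⟨s, t, rfl⟩
    exact ⟨t, by simp; ring, by simp; ring⟩
  · rintro ⟨t, h1, h2⟩
    refine ⟨x 0, t, ?_⟩
    ext i
    fin_cases i
    · simp
    · simp [h1]; ring
    · simp [h2]; ring

theorem mem_LL_self : x ∈ LL p p ↔ x 0 = 0 ∧ ∃ t, x 1 = p * t := by
  rw [LL, if_neg (lt_irrefl p), if_pos rfl, Submodule.mem_span_pair]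
  constructor
  · rintro ⟨s, t, rfl⟩
    exact ⟨by simp, t, by simp [mul_comm]⟩
  · rintro ⟨h0, t, h1⟩
    refine ⟨x 2, t, ?_⟩
    ext i
    fin_cases i
    · simp [h0]
    · simp [h1, mul_comm]
    · simp

theorem mem_LL_succ : x ∈ LL p (p + 1) ↔ ∀ i, (p : ZMod (p ^ 2)) ∣ x i := by
  rw [LL, if_neg (by lia), if_neg (by lia), LinearMap.mem_range]
  constructor
  · rintro ⟨y, rfl⟩ i
    exact ⟨y i, by simp⟩
  · intro h
    choose y hy using h
    exact ⟨y, by ext i; simp [hy i]⟩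

end Membership

theorem natCard_setOf_dvd {p : ℕ} (hp : p ≠ 0) :
    Nat.card {x : ZMod (p ^ 2) | (p : ZMod (p ^ 2)) ∣ x} = p := by
  have hset : {x : ZMod (p ^ 2) | (p : ZMod (p ^ 2)) ∣ x} =
      (AddSubgroup.zmultiples (p : ZMod (p ^ 2)) : Set (ZMod (p ^ 2))) := by
    ext x
    simp only [Set.mem_ofPred_eq, SetLike.mem_coe, AddSubgroup.mem_zmultiples_iff]
    constructor
    · rintro ⟨t, rfl⟩
      obtain ⟨n, rfl⟩ := ZMod.intCast_surjective t
      exact ⟨n, by simp [mul_comm]⟩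
    · rintro ⟨n, rfl⟩
      exact ⟨n, by simp [mul_comm]⟩
  rw [hset]
  refine (Nat.card_zmultiples _).trans ?_
  rw [ZMod.addOrderOf_coe _ (pow_ne_zero 2 hp), pow_two, Nat.gcd_mul_left_left,
    Nat.mul_div_cancel _ (Nat.pos_of_ne_zero hp)]

theorem Submodule.natCard_eq_of_mem_iff_mem_image {R M α : Type*} [Semiring R] [AddCommMonoid M]
    [Module R M] {N : Submodule R M} {f : α → M} (hf : Function.Injective f) {s : Set α}
    (h : ∀ x, x ∈ N ↔ x ∈ f '' s) : Nat.card N = Nat.card s := by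
  rw [← Nat.card_image_of_injective hf s]
  exact Nat.card_congr (Equiv.subtypeEquivRight h)

theorem ZMod.isUnit_natCast_sub_natCast {p i j : ℕ} (hp : p.Prime) (hij : i < j) (hj : j < p) :
    IsUnit ((j : ZMod (p ^ 2)) - i) := by
  rw [← Nat.cast_sub hij.le, ZMod.isUnit_iff_coprime]
  exact (Nat.coprime_of_lt_prime (by lia) (by lia) hp).symm.pow_right 2

theorem ZMod.two_mul_inv_two_of_odd {p : ℕ} (hodd : Odd p) :
    (2 : ZMod (p ^ 2)) * 2⁻¹ = 1 := by
  have h := ZMod.coe_mul_inv_eq_one (n := p ^ 2) 2 (hodd.coprime_two_left.pow_right 2)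
  simpa using h

theorem natCard_LL_inf_of_lt {p i j : ℕ} (hp : p.Prime) (hodd : Odd p) (hij : i < j)
    (hj : j < p) : Nat.card ↥(LL p i ⊓ LL p j) = p := by
  have htwo := ZMod.two_mul_inv_two_of_odd hodd
  obtain ⟨d, hd⟩ := (ZMod.isUnit_natCast_sub_natCast hp hij hj).exists_right_inv
  set c : ZMod (p ^ 2) := 2⁻¹
  let f : ZMod (p ^ 2) → Fin 3 → ZMod (p ^ 2) := fun u => ![u, c * (i + j) * u, -(c * i * j * u)]
  have hf : Function.Injective f := fun u v h => by simpa [f] using congrFun h 0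
  rw [Submodule.natCard_eq_of_mem_iff_mem_image hf (s := {x | (p : ZMod (p ^ 2)) ∣ x}),
    natCard_setOf_dvd hp.ne_zero]
  intro x
  rw [Submodule.mem_inf, mem_LL_of_lt (hij.trans hj), mem_LL_of_lt hj]
  constructor
  · rintro ⟨⟨t, h1, h2⟩, t', h1', h2'⟩
    have hpt : p * t = c * (j - i) * x 0 := by
      linear_combination (-(p * t) + c * (j - i) * x 0) * hd - d * (h2 - h2')
        - d * j * (h1 - h1') - d * (j - i) * j * x 0 * htwo
    refine ⟨x 0, ⟨d * (t - t'), ?_⟩, ?_⟩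
    · linear_combination -x 0 * hd + d * (h1 - h1')
    · ext m
      fin_cases m
      · simp [f]
      · simp [f]
        linear_combination -h1 - hpt + i * x 0 * htwo
      · simp [f]
        linear_combination -h2 + i * hpt
  · rintro ⟨u, ⟨v, rfl⟩, rfl⟩
    refine ⟨⟨c * (j - i) * v, ?_, ?_⟩, ⟨-(c * (j - i) * v), ?_, ?_⟩⟩
    · simp [f]
      linear_combination i * p * v * htwo
    · simp [f]
      ring
    · simp [f]
      linear_combination j * p * v * htwo
    · simp [f]
      ring

theorem natCard_LL_inf_LL_self {p i : ℕ} (hp : p ≠ 0) (hi : i < p) :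
    Nat.card ↥(LL p i ⊓ LL p p) = p := by
  let f : ZMod (p ^ 2) → Fin 3 → ZMod (p ^ 2) := fun u => ![0, u, -(i * u)]
  have hf : Function.Injective f := fun u v h => by simpa [f] using congrFun h 1
  rw [Submodule.natCard_eq_of_mem_iff_mem_image hf (s := {x | (p : ZMod (p ^ 2)) ∣ x}),
    natCard_setOf_dvd hp]
  intro x
  rw [Submodule.mem_inf, mem_LL_of_lt hi, mem_LL_self]
  constructor
  · rintro ⟨⟨t, h1, h2⟩, h0, t', h1'⟩
    refine ⟨x 1, ⟨t', h1'⟩, ?_⟩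
    ext m
    fin_cases m
    · simp [f, h0]
    · simp [f]
    · simp [f, h1, h2, h0]
      ring
  · rintro ⟨u, ⟨v, rfl⟩, rfl⟩
    refine ⟨⟨v, ?_, ?_⟩, ?_, v, ?_⟩ <;> simp [f]
    ring

theorem natCard_LL_inf_LL_succ_of_lt {p i : ℕ} (hp : p ≠ 0) (hi : i < p) :
    Nat.card ↥(LL p i ⊓ LL p (p + 1)) = p ^ 2 := by
  let f : ZMod (p ^ 2) × ZMod (p ^ 2) → Fin 3 → ZMod (p ^ 2) := fun u =>
    ![u.1, u.2, -(2⁻¹ * (i : ZMod (p ^ 2)) ^ 2 * u.1) - i * (u.2 - i * u.1)]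
  have hf : Function.Injective f := fun u v h =>
    Prod.ext (by simpa [f] using congrFun h 0) (by simpa [f] using congrFun h 1)
  rw [Submodule.natCard_eq_of_mem_iff_mem_image hf
      (s := {x | (p : ZMod (p ^ 2)) ∣ x} ×ˢ {x | (p : ZMod (p ^ 2)) ∣ x}),
    Nat.card_congr (Equiv.Set.prod _ _), Nat.card_prod, natCard_setOf_dvd hp, pow_two]
  intro x
  rw [Submodule.mem_inf, mem_LL_of_lt hi, mem_LL_succ]
  constructor
  · rintro ⟨⟨t, h1, h2⟩, h⟩
    refine ⟨(x 0, x 1), ⟨h 0, h 1⟩, ?_⟩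
    ext m
    fin_cases m
    · simp [f]
    · simp [f]
    · simp [f, h1, h2]
      ring
  · rintro ⟨⟨_, _⟩, ⟨⟨u, rfl⟩, ⟨v, rfl⟩⟩, rfl⟩
    refine ⟨⟨v - i * u, ?_, ?_⟩, fun m => ?_⟩
    · simp [f]
      ring
    · simp [f]
      ring
    · fin_cases m
      · exact ⟨u, by simp [f]⟩
      · exact ⟨v, by simp [f]⟩
      · exact ⟨-(2⁻¹ * (i : ZMod (p ^ 2)) ^ 2 * u) - i * (v - i * u), by simp [f]; ring⟩

theorem natCard_LL_self_inf_LL_succ {p : ℕ} (hp : p ≠ 0) :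
    Nat.card ↥(LL p p ⊓ LL p (p + 1)) = p ^ 2 := by
  let f : ZMod (p ^ 2) × ZMod (p ^ 2) → Fin 3 → ZMod (p ^ 2) := fun u => ![0, u.1, u.2]
  have hf : Function.Injective f := fun u v h =>
    Prod.ext (by simpa [f] using congrFun h 1) (by simpa [f] using congrFun h 2)
  rw [Submodule.natCard_eq_of_mem_iff_mem_image hf
      (s := {x | (p : ZMod (p ^ 2)) ∣ x} ×ˢ {x | (p : ZMod (p ^ 2)) ∣ x}),
    Nat.card_congr (Equiv.Set.prod _ _), Nat.card_prod, natCard_setOf_dvd hp, pow_two]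
  intro x
  rw [Submodule.mem_inf, mem_LL_self, mem_LL_succ]
  constructor
  · rintro ⟨⟨h0, -⟩, h⟩
    refine ⟨(x 1, x 2), ⟨h 1, h 2⟩, ?_⟩
    ext m
    fin_cases m <;> simp [f, h0]
  · rintro ⟨⟨_, _⟩, ⟨⟨u, rfl⟩, ⟨v, rfl⟩⟩, rfl⟩
    refine ⟨⟨by simp [f], u, by simp [f]⟩, fun m => ?_⟩
    fin_cases m <;> simp [f]

/-- Intersection cardinalities: (i) for `0 ≤ i < j ≤ p`, `|L_i ∩ L_j| = p`;
(ii) for `0 ≤ i ≤ p`, `|L_i ∩ L_{p+1}| = p²`. -/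
theorem lagrangian_intersections_rank3 (p : ℕ) (hp : p.Prime) (hodd : Odd p) :
    (∀ i j : ℕ, i < j → j ≤ p → Nat.card ↥(LL p i ⊓ LL p j) = p) ∧
    (∀ i : ℕ, i ≤ p → Nat.card ↥(LL p i ⊓ LL p (p + 1)) = p ^ 2) := by
  refine ⟨fun i j hij hj => ?_, fun i hi => ?_⟩
  · rcases hj.lt_or_eq with hj | rfl
    · exact natCard_LL_inf_of_lt hp hodd hij hj
    · exact natCard_LL_inf_LL_self hp.ne_zero hij
  · rcases hi.lt_or_eq with hi | rfl
    · exact natCard_LL_inf_LL_succ_of_lt hp.ne_zero hi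
    · exact natCard_LL_self_inf_LL_succ hp.ne_zero
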